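/- Let A=(C,m) be a 3-dimensional toric idealistic cluster and let Q_i, Q_j be nodes such that Q_j is proximate to Q_i or Q_i is proximate to Q_j, with χ_i = 0, χ_j < 0 and ν_i·N_j = ν_j·N_i. If moreover m_i² > Σ_{k→i} m_k² or m_j² > Σ_{k→j} m_k² (i.e. at least one of the two associated valuations is a Rees valuation), then ν_i = N_i; that is, the common candidate pole −ν_i/N_i equals −1. -/

import Mathlib

open Finset

/-!
Common framework: 3-dimensional toric constellations and toric idealistic clusters.
The edge labels `1, 2, 3` of the paper are encoded as `0, 1, 2 : Fin 3`.
-/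

/-- A 3-dimensional toric constellation: a finite rooted tree on nodes `0, …, r−1`
(node `0` the root, every child having larger index than its parent), each node having
at most three children, the edges from a node to its children carrying pairwise
distinct labels in `Fin 3`.  `label j` is the label of the edge from `parent j` to `j`
(irrelevant for the root). -/
structure ToricConstellation (r : ℕ) where
  parent : Fin r → Fin r
  label : Fin r → Fin 3
  parent_lt : ∀ i : Fin r, 0 < (i : ℕ) → (parent i : ℕ) < (i : ℕ)
  parent_root : ∀ i : Fin r, (i : ℕ) = 0 → parent i = i
  label_distinct : ∀ i j : Fin r, 0 < (i : ℕ) → 0 < (j : ℕ) → i ≠ j →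
    parent i = parent j → label i ≠ label j

namespace ToricConstellation

variable {r : ℕ}

/-- The ordered triple of vectors of `ℤ³` attached to a node: the root carries the
standard basis, and the child along the edge labelled `a` of a node with cone
`(u₁,u₂,u₃)` carries the triple obtained by replacing `u_a` with `u₁+u₂+u₃`. -/
def cone (C : ToricConstellation r) (i : Fin r) : Fin 3 → (Fin 3 → ℤ) :=
  if h : 0 < (i : ℕ) then
    Function.update (cone C (C.parent i)) (C.label i) (∑ a, cone C (C.parent i) a)
  else fun a => Pi.single a 1
termination_by (i : ℕ)
decreasing_by all_goals exact C.parent_lt i h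

/-- `v(Q) = u₁ + u₂ + u₃`, the sum of the cone vectors of a node. -/
def v (C : ToricConstellation r) (i : Fin r) : Fin 3 → ℤ := ∑ a, cone C i a

/-- `Prox C j i` means `j → i`, i.e. `Q_j` is proximate to `Q_i`:
`j ≠ i` and `v(Q_i)` is an entry of `cone(Q_j)`. -/
def Prox (C : ToricConstellation r) (j i : Fin r) : Prop :=
  j ≠ i ∧ ∃ a : Fin 3, cone C j a = v C i

instance (C : ToricConstellation r) (j i : Fin r) : Decidable (C.Prox j i) := by
  unfold Prox; infer_instance

/-- `inChain C i a b j = true` iff `j = Q_i(a, b^t)` for some `t ≥ 0`, i.e. `j` is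
reached from `i` by one edge labelled `a` followed by `t` edges labelled `b`. -/
def inChain (C : ToricConstellation r) (i : Fin r) (a b : Fin 3) (j : Fin r) : Bool :=
  if h : 0 < (j : ℕ) then
    (decide (C.parent j = i) && decide (C.label j = a)) ||
      (decide (C.label j = b) && inChain C i a b (C.parent j))
  else false
termination_by (j : ℕ)
decreasing_by exact C.parent_lt j h

/-- `LinProx C j i` means `j ↠ i`, i.e. `Q_j` is linearly proximate to `Q_i`. -/
def LinProx (C : ToricConstellation r) (j i : Fin r) : Prop :=
  ∃ a b : Fin 3, a ≠ b ∧ inChain C i a b j = true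

instance (C : ToricConstellation r) (j i : Fin r) : Decidable (C.LinProx j i) := by
  unfold LinProx; infer_instance

/-- `j` is a child of `i`. -/
def IsChild (C : ToricConstellation r) (j i : Fin r) : Prop :=
  0 < (j : ℕ) ∧ C.parent j = i

instance (C : ToricConstellation r) (j i : Fin r) : Decidable (C.IsChild j i) := by
  unfold IsChild; infer_instance

/-- The set `S_i` of labels of the edges on the path from the root to `Q_i`. -/
def labelsUnder (C : ToricConstellation r) (i : Fin r) : Finset (Fin 3) :=
  if h : 0 < (i : ℕ) then insert (C.label i) (labelsUnder C (C.parent i)) else ∅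
termination_by (i : ℕ)
decreasing_by exact C.parent_lt i h

/-- `i` is a weak ancestor of `j` (`i = j` or `i` a strict ancestor of `j`). -/
def anc (C : ToricConstellation r) (i j : Fin r) : Bool :=
  decide (i = j) || (if h : 0 < (j : ℕ) then anc C i (C.parent j) else false)
termination_by (j : ℕ)
decreasing_by exact C.parent_lt j h

/-- The set of nodes weakly above `i` (`i` together with its descendants). -/
def weakAbove (C : ToricConstellation r) (i : Fin r) : Finset (Fin r) :=
  univ.filter (fun j => anc C i j = true)

end ToricConstellation

/-- A 3-dimensional toric cluster: a toric constellation together with a positive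
integer weight for each node. -/
structure ToricCluster (r : ℕ) extends ToricConstellation r where
  m : Fin r → ℤ
  m_pos : ∀ j, 0 < m j

namespace ToricCluster

open ToricConstellation

variable {r : ℕ}

/-- `M_{Q_i}(a,b) := Σ_{t ≥ 0, Q_i(a,b^t) ∈ C} m_{Q_i(a,b^t)}`. -/
def M (A : ToricCluster r) (i : Fin r) (a b : Fin 3) : ℤ :=
  ∑ j ∈ univ.filter (fun j => inChain A.toToricConstellation i a b j = true), A.m j

/-- The cluster is idealistic: the linear proximity inequalities
`M_{Q_i}(a,b) + M_{Q_i}(b,a) ≤ m_{Q_i}` hold. -/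
def Idealistic (A : ToricCluster r) : Prop :=
  ∀ i : Fin r, ∀ a b : Fin 3, a ≠ b → A.M i a b + A.M i b a ≤ A.m i

/-- The set of nodes `j` proximate to `i` (`j → i`). -/
def proxSet (A : ToricCluster r) (i : Fin r) : Finset (Fin r) :=
  univ.filter (fun j => Prox A.toToricConstellation j i)

/-- `B_i`: the set of nodes to which `i` is proximate. -/
def Bset (A : ToricCluster r) (i : Fin r) : Finset (Fin r) :=
  univ.filter (fun j => Prox A.toToricConstellation i j)

/-- `A_i`: the children `k` of `i` for which there is no `l` with `i → l` and `k → l`. -/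
def Aset (A : ToricCluster r) (i : Fin r) : Finset (Fin r) :=
  univ.filter (fun k => IsChild A.toToricConstellation k i ∧
    ¬ ∃ l, Prox A.toToricConstellation i l ∧ Prox A.toToricConstellation k l)

/-- The Euler characteristic `χ_i = χ(E_i°)`. -/
def chi (A : ToricCluster r) (i : Fin r) : ℤ :=
  3 + A.m i * (A.m i - 3)
    - ∑ j ∈ A.proxSet i, A.m j * (A.m j - 1)
    + ∑ j ∈ A.proxSet i,
        (A.m j - ∑ k ∈ (A.proxSet i).filter
          (fun k => LinProx A.toToricConstellation k j), A.m k)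
    + ∑ j ∈ A.Bset i,
        (A.m i - ∑ k ∈ (A.proxSet j).filter
          (fun k => LinProx A.toToricConstellation k i), A.m k)
    - ((A.Aset i).card : ℤ) - 2 * ((A.Bset i).card : ℤ)
    + (((A.Bset i).card.choose 2 : ℕ) : ℤ)

/-- `D_i = m_i² − Σ_{j→i} m_j²`. -/
def D (A : ToricCluster r) (i : Fin r) : ℤ :=
  A.m i ^ 2 - ∑ j ∈ A.proxSet i, A.m j ^ 2

/-- `r_{ab} = m_i − M_{Q_i}(a,b) − M_{Q_i}(b,a)`. -/
def rab (A : ToricCluster r) (i : Fin r) (a b : Fin 3) : ℤ :=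
  A.m i - A.M i a b - A.M i b a

/-- `R_i = r̂_{12} + r̂_{13} + r̂_{23}`, where `r̂_{ab} = r_{ab}` if the remaining third
label does not appear under `Q_i`, and `r̂_{ab} = 0` otherwise.  (Labels `1,2,3` are
encoded as `0,1,2 : Fin 3`.) -/
def R (A : ToricCluster r) (i : Fin r) : ℤ :=
  (if (2 : Fin 3) ∉ labelsUnder A.toToricConstellation i then A.rab i 0 1 else 0)
  + (if (1 : Fin 3) ∉ labelsUnder A.toToricConstellation i then A.rab i 0 2 else 0)
  + (if (0 : Fin 3) ∉ labelsUnder A.toToricConstellation i then A.rab i 1 2 else 0)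

/-- `T_i = 3 − #A_i − 2·#B_i + (#B_i choose 2)`. -/
def T (A : ToricCluster r) (i : Fin r) : ℤ :=
  3 - ((A.Aset i).card : ℤ) - 2 * ((A.Bset i).card : ℤ)
    + (((A.Bset i).card.choose 2 : ℕ) : ℤ)

/-- The nodes to which `i` is proximate, of smaller index: the sums in the recursive
definitions of the numerical data range over the nodes to which `i` is proximate,
which are ancestors of `i` and hence have smaller index (making the recursion
well-founded). -/
def anteSet (A : ToricCluster r) (i : Fin r) : Finset (Fin r) :=
  univ.filter (fun j => (j : ℕ) < (i : ℕ) ∧ Prox A.toToricConstellation i j)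

/-- The numerical datum `N_i := m_i + Σ_{j : i→j} N_j`. -/
def N (A : ToricCluster r) (i : Fin r) : ℤ :=
  A.m i + ∑ j ∈ (A.anteSet i).attach, N A j.1
termination_by (i : ℕ)
decreasing_by
  have hj := j.2
  simp only [anteSet, Finset.mem_filter] at hj
  exact hj.2.1

/-- The numerical datum `ν_i := 3 + Σ_{j : i→j} (ν_j − 1)`. -/
def nu (A : ToricCluster r) (i : Fin r) : ℤ :=
  3 + ∑ j ∈ (A.anteSet i).attach, (nu A j.1 - 1)
termination_by (i : ℕ)
decreasing_by
  have hj := j.2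
  simp only [anteSet, Finset.mem_filter] at hj
  exact hj.2.1

end ToricCluster


namespace ToricConstellation

variable {r : ℕ}

theorem parent_induction (C : ToricConstellation r) {motive : Fin r → Prop}
    (root : ∀ k : Fin r, ¬ 0 < (k : ℕ) → motive k)
    (step : ∀ k : Fin r, 0 < (k : ℕ) → motive (C.parent k) → motive k) (k : Fin r) :
    motive k := by
  induction hn : (k : ℕ) using Nat.strong_induction_on generalizing k with
  | _ n ih =>
    by_cases h : 0 < (k : ℕ)
    · exact step k h (ih _ (hn ▸ C.parent_lt k h) _ rfl)
    · exact root k h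

/-- The node whose vector `v` is the entry `a` of the cone of `k`, if there is one. -/
def slot (C : ToricConstellation r) (k : Fin r) (a : Fin 3) : Option (Fin r) :=
  if h : 0 < (k : ℕ) then
    if C.label k = a then some (C.parent k) else slot C (C.parent k) a
  else none
termination_by (k : ℕ)
decreasing_by exact C.parent_lt k h

/-- `C.Reach L x k`: the path from `x` to its descendant `k` only uses labels in `L`. -/
inductive Reach (C : ToricConstellation r) (L : Set (Fin 3)) (x : Fin r) : Fin r → Prop
  | refl : Reach C L x x
  | step (k : Fin r) : 0 < (k : ℕ) → C.label k ∈ L → Reach C L x (C.parent k) → Reach C L x k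

/-- The vector with coordinates `α` with respect to the cone of `k`. -/
def combo (C : ToricConstellation r) (k : Fin r) (α : Fin 3 → ℤ) : Fin 3 → ℤ :=
  ∑ a, α a • C.cone k a

/-- The change of coordinates from the cone of the child with label `d` to the cone of
its parent. -/
def spread (d : Fin 3) (α : Fin 3 → ℤ) : Fin 3 → ℤ :=
  fun b => if b = d then α d else α d + α b

/-- The vector `u` lies in the interior of the cone of `k`. -/
def Interior (C : ToricConstellation r) (k : Fin r) (u : Fin 3 → ℤ) : Prop :=
  ∃ α : Fin 3 → ℤ, (∀ a, 0 < α a) ∧ C.combo k α = u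

section cones

variable (C : ToricConstellation r)

theorem combo_of_pos {k : Fin r} (h : 0 < (k : ℕ)) (α : Fin 3 → ℤ) :
    C.combo k α = C.combo (C.parent k) (spread (C.label k) α) := by
  funext t
  rw [combo, combo, cone, dif_pos h]
  generalize C.label k = d
  fin_cases d <;> simp [Fin.sum_univ_three, spread, Function.update] <;> ring

theorem combo_of_not_pos {k : Fin r} (h : ¬ 0 < (k : ℕ)) (α : Fin 3 → ℤ) :
    C.combo k α = α := by
  funext t
  rw [combo, cone, dif_neg h]
  fin_cases t <;> simp [Pi.single_apply]

theorem combo_one (k : Fin r) : C.combo k (fun _ => 1) = C.v k := by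
  simp [combo, v]

theorem spread_injective (d : Fin 3) : Function.Injective (spread d) := by
  intro α β h
  have h0 := congrFun h 0
  have h1 := congrFun h 1
  have h2 := congrFun h 2
  funext t
  fin_cases d <;> simp [spread] at h0 h1 h2 <;> fin_cases t <;> simp <;> omega

theorem combo_injective (k : Fin r) : Function.Injective (C.combo k) := by
  induction k using C.parent_induction with
  | root k h => intro α β e; rwa [combo_of_not_pos C h, combo_of_not_pos C h] at e
  | step k h ih =>
    intro α β e
    rw [combo_of_pos C h, combo_of_pos C h] at e
    exact spread_injective _ (ih e)

theorem spread_pos {d : Fin 3} {α : Fin 3 → ℤ} (h : ∀ a, 0 < α a) (a : Fin 3) :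
    0 < spread d α a := by
  have := h a
  have := h d
  unfold spread
  split <;> omega

theorem spread_lt {d a : Fin 3} {α : Fin 3 → ℤ} (h : ∀ a, 0 < α a) (ha : a ≠ d) :
    spread d α d < spread d α a := by
  have := h a
  simp [spread, ha, this]

theorem Interior.parent {C : ToricConstellation r} {k : Fin r} {u : Fin 3 → ℤ}
    (hu : C.Interior k u) (h : 0 < (k : ℕ)) : C.Interior (C.parent k) u := by
  obtain ⟨α, hα, rfl⟩ := hu
  exact ⟨_, spread_pos hα, (combo_of_pos C h α).symm⟩

theorem interior_v (k : Fin r) : C.Interior k (C.v k) :=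
  ⟨fun _ => 1, fun _ => one_pos, C.combo_one k⟩

theorem v_pos (k : Fin r) (t : Fin 3) : 0 < C.v k t := by
  have key : ∀ k u, C.Interior k u → ∀ t, 0 < u t := by
    intro k
    induction k using C.parent_induction with
    | root k h => rintro u ⟨α, hα, rfl⟩ t; rw [combo_of_not_pos C h]; exact hα t
    | step k h ih => exact fun u hu t => ih u (hu.parent h) t
  exact key k _ (C.interior_v k) t

end cones

namespace Reach

variable {C : ToricConstellation r} {L : Set (Fin 3)} {x y k : Fin r}

theorem le (h : C.Reach L x k) : (x : ℕ) ≤ k := by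
  induction h with
  | refl => exact le_rfl
  | step k hk _ _ ih => exact ih.trans (C.parent_lt k hk).le

theorem interior (h : C.Reach L x k) {u : Fin 3 → ℤ} (hu : C.Interior k u) :
    C.Interior x u := by
  induction h with
  | refl => exact hu
  | step k hk _ _ ih => exact ih (hu.parent hk)

theorem mono {L' : Set (Fin 3)} (hL : L ⊆ L') (h : C.Reach L x k) : C.Reach L' x k := by
  induction h with
  | refl => exact .refl
  | step k hk hl _ ih => exact .step k hk (hL hl) ih

theorem head (hc : C.IsChild y x) (hy : C.label y ∈ L) (h : C.Reach L y k) :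
    C.Reach L x k := by
  induction h with
  | refl => exact .step y hc.1 hy (hc.2 ▸ .refl)
  | step k hk hl _ ih => exact .step k hk hl ih

theorem eq_or_child (h : C.Reach L x k) :
    k = x ∨ ∃ y, C.IsChild y x ∧ C.label y ∈ L ∧ C.Reach L y k := by
  induction h with
  | refl => exact .inl rfl
  | step k hk hl _ ih =>
    right
    rcases ih with ih | ⟨y, hy, hyl, hr⟩
    · exact ⟨k, ⟨hk, ih⟩, hl, .refl⟩
    · exact ⟨y, hy, hyl, .step k hk hl hr⟩

theorem child_unique {L' : Set (Fin 3)} {y' : Fin r} (h : C.Reach L y k)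
    (h' : C.Reach L' y' k) (hy : C.IsChild y x) (hy' : C.IsChild y' x) : y = y' := by
  have lt_of {z : Fin r} (hz : C.IsChild z x) : (x : ℕ) < z := hz.2 ▸ C.parent_lt z hz.1
  induction h with
  | refl =>
    cases h' with
    | refl => rfl
    | step _ _ _ h' => exact absurd h'.le (by rw [hy.2]; exact not_le.2 (lt_of hy'))
  | step k hk hl hr ih =>
    cases h' with
    | refl => exact absurd hr.le (by rw [hy'.2]; exact not_le.2 (lt_of hy))
    | step _ _ _ h' => exact ih h'

end Reach

section proximity

variable (C : ToricConstellation r)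

theorem reach_root (k x : Fin r) (hx : ¬ 0 < (x : ℕ)) : C.Reach Set.univ x k := by
  induction k using C.parent_induction with
  | root k h =>
    have : k = x := Fin.ext (by omega)
    exact this ▸ .refl
  | step k h ih => exact .step k h trivial ih

theorem child_eq {x y y' : Fin r} (hy : C.IsChild y x) (hy' : C.IsChild y' x)
    (hl : C.label y = C.label y') : y = y' := by
  by_contra hne
  exact C.label_distinct y y' hy.1 hy'.1 hne (hy.2.trans hy'.2.symm) hl

theorem reach_of_interior {u : Fin 3 → ℤ} {k : Fin r} (hk : C.Interior k u) (l : Fin r)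
    (hl : C.Interior l u) : C.Reach Set.univ k l ∨ C.Reach Set.univ l k := by
  induction l using C.parent_induction with
  | root l h => exact .inr (C.reach_root k l h)
  | step l h ih =>
    rcases ih (hl.parent h) with hr | hr
    · exact .inl (.step l h trivial hr)
    · rcases hr.eq_or_child with rfl | ⟨y, hy, -, hyk⟩
      · exact .inl (.step l h trivial .refl)
      · by_cases hlab : C.label y = C.label l
        · rw [C.child_eq hy ⟨h, rfl⟩ hlab] at hyk
          exact .inr hyk
        · obtain ⟨α, hα, h1⟩ := hl
          obtain ⟨β, hβ, h2⟩ := hyk.interior hk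
          rw [combo_of_pos C h] at h1
          rw [combo_of_pos C hy.1, hy.2, ← h1] at h2
          have h3 := C.combo_injective _ h2
          have h4 := spread_lt (d := C.label y) hβ (Ne.symm hlab)
          have h5 := spread_lt (d := C.label l) hα hlab
          rw [h3] at h4
          exact absurd h4 (not_lt.2 h5.le)

theorem v_injective : Function.Injective C.v := by
  have key : ∀ {k l}, C.v k = C.v l → C.Reach Set.univ k l → l = k := by
    intro k l e hr
    rcases hr.eq_or_child with h | ⟨y, hy, -, hyl⟩
    · exact h
    · obtain ⟨β, hβ, h⟩ := hyl.interior (C.interior_v l)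
      rw [combo_of_pos C hy.1, hy.2, ← e, ← C.combo_one k] at h
      have h3 := C.combo_injective _ h
      obtain ⟨a, ha⟩ := exists_ne (C.label y)
      have h4 := spread_lt hβ ha
      rw [h3] at h4
      exact absurd h4 (lt_irrefl _)
  intro k l e
  rcases C.reach_of_interior (C.interior_v k) l (e ▸ C.interior_v l) with h | h
  · exact (key e h).symm
  · exact key e.symm h

theorem slot_of_pos {k : Fin r} (h : 0 < (k : ℕ)) (a : Fin 3) :
    C.slot k a = if C.label k = a then some (C.parent k) else C.slot (C.parent k) a := by
  rw [slot, dif_pos h]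

theorem slot_of_not_pos {k : Fin r} (h : ¬ 0 < (k : ℕ)) (a : Fin 3) : C.slot k a = none := by
  rw [slot, dif_neg h]

theorem slot_lt {k l : Fin r} {a : Fin 3} : C.slot k a = some l → (l : ℕ) < k := by
  induction k using C.parent_induction with
  | root k h => simp [C.slot_of_not_pos h]
  | step k h ih =>
    rw [C.slot_of_pos h]
    split
    · rintro ⟨⟩; exact C.parent_lt k h
    · exact fun e => (ih e).trans (C.parent_lt k h)

theorem slot_inj {k l : Fin r} {a b : Fin 3} :
    C.slot k a = some l → C.slot k b = some l → a = b := by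
  induction k using C.parent_induction with
  | root k h => simp [C.slot_of_not_pos h]
  | step k h ih =>
    rw [C.slot_of_pos h, C.slot_of_pos h]
    split_ifs with h1 h2 h2
    · exact fun _ _ => h1.symm.trans h2
    · rintro ⟨⟩ e; exact absurd (C.slot_lt e) (lt_irrefl _)
    · rintro e ⟨⟩; exact absurd (C.slot_lt e) (lt_irrefl _)
    · exact ih

theorem cone_eq (k : Fin r) (a : Fin 3) :
    C.cone k a = (C.slot k a).elim (Pi.single a 1) C.v := by
  induction k using C.parent_induction with
  | root k h => rw [cone, dif_neg h, C.slot_of_not_pos h]; rfl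
  | step k h ih =>
    rw [cone, dif_pos h, C.slot_of_pos h]
    by_cases ha : C.label k = a
    · subst ha; simp [v]
    · rw [Function.update_of_ne (Ne.symm ha), if_neg ha, ih]

theorem prox_iff {k l : Fin r} : C.Prox k l ↔ ∃ a, C.slot k a = some l := by
  constructor
  · rintro ⟨-, a, ha⟩
    refine ⟨a, ?_⟩
    rw [C.cone_eq] at ha
    cases hs : C.slot k a with
    | none =>
      rw [hs] at ha
      obtain ⟨t, ht⟩ := exists_ne a
      have h1 := congrFun ha t
      have h2 := C.v_pos l t
      simp [ht] at h1
      omega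
    | some l' =>
      rw [hs] at ha
      rw [C.v_injective ha]
  · rintro ⟨a, ha⟩
    refine ⟨?_, a, by rw [C.cone_eq, ha]; rfl⟩
    rintro rfl
    exact absurd (C.slot_lt ha) (lt_irrefl _)

theorem slot_eq_some_iff {i k : Fin r} {a : Fin 3} :
    C.slot k a = some i ↔ ∃ y, C.IsChild y i ∧ C.label y = a ∧ C.Reach {a}ᶜ y k := by
  constructor
  · induction k using C.parent_induction with
    | root k h => simp [C.slot_of_not_pos h]
    | step k h ih =>
      rw [C.slot_of_pos h]
      split_ifs with hl
      · rintro ⟨⟩; exact ⟨k, ⟨h, rfl⟩, hl, .refl⟩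
      · intro e
        obtain ⟨y, hy, hyl, hr⟩ := ih e
        exact ⟨y, hy, hyl, .step k h hl hr⟩
  · rintro ⟨y, hy, hyl, hr⟩
    induction hr with
    | refl => rw [C.slot_of_pos hy.1, if_pos hyl, hy.2]
    | step k hk hl _ ih => rw [C.slot_of_pos hk, if_neg (show C.label k ≠ a from hl), ih]

theorem inChain_iff {i k : Fin r} {a b : Fin 3} :
    C.inChain i a b k = true ↔ ∃ y, C.IsChild y i ∧ C.label y = a ∧ C.Reach {b} y k := by
  constructor
  · induction k using C.parent_induction with
    | root k h => rw [inChain, dif_neg h]; simp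
    | step k h ih =>
      rw [inChain, dif_pos h]
      simp only [Bool.or_eq_true, Bool.and_eq_true, decide_eq_true_eq]
      rintro (⟨h1, h2⟩ | ⟨h1, h2⟩)
      · exact ⟨k, ⟨h, h1⟩, h2, .refl⟩
      · obtain ⟨y, hy, hyl, hr⟩ := ih h2
        exact ⟨y, hy, hyl, .step k h h1 hr⟩
  · rintro ⟨y, hy, hyl, hr⟩
    induction hr with
    | refl => rw [inChain, dif_pos hy.1]; simp [hy.2, hyl]
    | step k hk hl _ ih => rw [inChain, dif_pos hk, ih, show C.label k = b from hl]; simp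

theorem Reach.slot_eq_or {C : ToricConstellation r} {L : Set (Fin 3)} {x k : Fin r}
    (h : C.Reach L x k) (a : Fin 3) :
    C.slot k a = C.slot x a ∨ a ∈ L ∧ ∃ l, C.slot k a = some l ∧ (x : ℕ) ≤ l := by
  induction h with
  | refl => exact .inl rfl
  | step k hk hl hr ih =>
    rw [C.slot_of_pos hk]
    split_ifs with e
    · exact .inr ⟨e ▸ hl, _, rfl, hr.le⟩
    · exact ih

theorem slot_child {x y : Fin r} (h : C.IsChild y x) (a : Fin 3) :
    C.slot y a = if C.label y = a then some x else C.slot x a := by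
  rw [C.slot_of_pos h.1, h.2]

theorem IsChild.lt {C : ToricConstellation r} {x y : Fin r} (h : C.IsChild y x) :
    (x : ℕ) < y := h.2 ▸ C.parent_lt y h.1

theorem eq_of_ne {a b c : Fin 3} (hab : a ≠ b) (hac : a ≠ c) (hbc : b ≠ c) (d : Fin 3) :
    d = a ∨ d = b ∨ d = c := by
  revert a b c d; decide

theorem prox_and_linProx_iff {i j k : Fin r} {a b c : Fin 3} (hab : a ≠ b) (hac : a ≠ c)
    (hbc : b ≠ c) (hj : C.slot j a = some i) :
    C.Prox k i ∧ C.LinProx k j ↔ C.inChain j b c k = true ∨ C.inChain j c b k = true := by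
  have back : ∀ {d e}, d ≠ a → e ≠ a → d ≠ e → C.inChain j d e k = true →
      C.Prox k i ∧ C.LinProx k j := by
    intro d e hd he hde h
    refine ⟨C.prox_iff.2 ⟨a, ?_⟩, d, e, hde, h⟩
    obtain ⟨y, hy, hyl, hr⟩ := C.inChain_iff.1 h
    rcases hr.slot_eq_or a with h1 | h1
    · rw [h1, C.slot_child hy, hyl, if_neg hd, hj]
    · exact absurd h1.1.symm he
  constructor
  · rintro ⟨hp, d, e, hde, h⟩
    obtain ⟨y, hy, hyl, hr⟩ := C.inChain_iff.1 h
    obtain ⟨a', ha'⟩ := C.prox_iff.1 hp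
    have hij := C.slot_lt hj
    have hjy := hy.lt
    have h1 : C.slot k a' = C.slot y a' := by
      rcases hr.slot_eq_or a' with h1 | ⟨-, l, h1, h2⟩
      · exact h1
      · rw [ha'] at h1; cases h1; omega
    rw [ha', C.slot_child hy] at h1
    split_ifs at h1 with h2
    · cases h1; omega
    have h3 : a' = a := C.slot_inj h1.symm hj
    subst h3
    rw [hyl] at h2
    by_cases he : e = a'
    · subst he
      have hk : k = y := by
        cases hr with
        | refl => rfl
        | step _ hk hl hr' =>
          rw [C.slot_of_pos hk, if_pos (show C.label k = e from hl)] at ha'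
          cases ha'
          have := hr'.le
          omega
      subst hk
      rcases eq_of_ne hab hac hbc d with h | h | h
      · exact absurd h.symm hde.symm
      · exact .inl (C.inChain_iff.2 ⟨k, hy, hyl.trans h, .refl⟩)
      · exact .inr (C.inChain_iff.2 ⟨k, hy, hyl.trans h, .refl⟩)
    · rcases eq_of_ne hab hac hbc d with h4 | h4 | h4
      · exact absurd h4 h2
      all_goals
        rcases eq_of_ne hab hac hbc e with h5 | h5 | h5
        · exact absurd h5 he
        all_goals first
          | exact absurd (h4.trans h5.symm) hde
          | rw [h4, h5] at h; first | exact .inl h | exact .inr h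
  · rintro (h | h)
    · exact back hab.symm hac.symm hbc h
    · exact back hac.symm hab.symm hbc.symm h

end proximity

end ToricConstellation

namespace ToricConstellation

variable {r : ℕ} (C : ToricConstellation r)

theorem child_induction {motive : Fin r → Prop}
    (step : ∀ x : Fin r, (∀ y, C.IsChild y x → motive y) → motive x) (x : Fin r) :
    motive x := by
  induction hn : r - (x : ℕ) using Nat.strong_induction_on generalizing x with
  | _ n ih =>
    refine step x fun y hy => ih _ ?_ y rfl
    have := hy.lt
    have := y.2
    omega

/-- The children of `i` with label `a`; there is at most one. -/
def children (i : Fin r) (a : Fin 3) : Finset (Fin r) :=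
  univ.filter fun y => C.IsChild y i ∧ C.label y = a

open Classical in
/-- The sum of `f` over the nodes reached from `x` along edges with label in `L`. -/
noncomputable def treeSum (L : Set (Fin 3)) (f : Fin r → ℤ) (x : Fin r) : ℤ :=
  ∑ k ∈ univ.filter (fun k => C.Reach L x k), f k

/-- The sum of `f` over the nodes proximate to `i` that lie above the child with label `a`. -/
def slotSum (i : Fin r) (a : Fin 3) (f : Fin r → ℤ) : ℤ :=
  ∑ k ∈ univ.filter (fun k => C.slot k a = some i), f k

theorem mem_children {i y : Fin r} {a : Fin 3} :
    y ∈ C.children i a ↔ C.IsChild y i ∧ C.label y = a := by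
  simp [children]

theorem children_cases (i : Fin r) (a : Fin 3) :
    C.children i a = ∅ ∨
      ∃ y, C.IsChild y i ∧ C.label y = a ∧ C.children i a = {y} := by
  rcases (C.children i a).eq_empty_or_nonempty with h | ⟨y, hy⟩
  · exact .inl h
  · have hy' := C.mem_children.1 hy
    refine .inr ⟨y, hy'.1, hy'.2, ?_⟩
    refine Finset.eq_singleton_iff_unique_mem.2 ⟨hy, fun z hz => ?_⟩
    have hz' := C.mem_children.1 hz
    exact C.child_eq hz'.1 hy'.1 (hz'.2.trans hy'.2.symm)

theorem sum_three {a b c : Fin 3} (hab : a ≠ b) (hac : a ≠ c) (hbc : b ≠ c)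
    (f : Fin 3 → ℤ) : ∑ d, f d = f a + f b + f c := by
  have : (univ : Finset (Fin 3)) = {a, b, c} := by
    ext d; simpa using eq_of_ne hab hac hbc d
  rw [this, Finset.sum_insert (by simp [hab, hac]), Finset.sum_insert (by simp [hbc]),
    Finset.sum_singleton, add_assoc]

theorem sum_filter_reach (P : Fin r → Prop) [DecidablePred P] {i : Fin r} {a : Fin 3}
    {L : Set (Fin 3)}
    (hP : ∀ k, P k ↔ ∃ y, C.IsChild y i ∧ C.label y = a ∧ C.Reach L y k) (f : Fin r → ℤ) :
    ∑ k ∈ univ.filter P, f k = ∑ y ∈ C.children i a, C.treeSum L f y := by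
  classical
  rcases C.children_cases i a with h | ⟨y, hy, hl, h⟩
  · rw [h, Finset.sum_empty]
    refine Finset.sum_eq_zero fun k hk => ?_
    obtain ⟨y, hy, hl, -⟩ := (hP k).1 (Finset.mem_filter.1 hk).2
    have : y ∈ C.children i a := C.mem_children.2 ⟨hy, hl⟩
    simp [h] at this
  · rw [h, Finset.sum_singleton, treeSum]
    refine Finset.sum_congr (Finset.filter_congr fun k _ => ?_) fun _ _ => rfl
    rw [hP]
    constructor
    · rintro ⟨z, hz, hzl, hr⟩
      rwa [C.child_eq hy hz (hl.trans hzl.symm)]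
    · exact fun hr => ⟨y, hy, hl, hr⟩

theorem treeSum_eq (L : Set (Fin 3)) [DecidablePred (· ∈ L)] (f : Fin r → ℤ) (x : Fin r) :
    C.treeSum L f x =
      f x + ∑ d, if d ∈ L then ∑ y ∈ C.children x d, C.treeSum L f y else 0 := by
  classical
  have hset : univ.filter (fun k => C.Reach L x k) =
      insert x ((univ.filter fun y => C.IsChild y x ∧ C.label y ∈ L).biUnion
        fun y => univ.filter fun k => C.Reach L y k) := by
    ext k
    simp only [mem_filter, mem_univ, true_and, mem_insert, mem_biUnion]
    constructor
    · intro h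
      rcases h.eq_or_child with h | ⟨y, hy, hl, hr⟩
      · exact .inl h
      · exact .inr ⟨y, ⟨hy, hl⟩, hr⟩
    · rintro (rfl | ⟨y, ⟨hy, hl⟩, hr⟩)
      · exact .refl
      · exact hr.head hy hl
  rw [treeSum, hset, Finset.sum_insert, Finset.sum_biUnion]
  · congr 1
    rw [← Finset.sum_fiberwise _ C.label]
    refine Finset.sum_congr rfl fun d _ => ?_
    split_ifs with hd
    · refine Finset.sum_congr ?_ fun _ _ => rfl
      ext y
      simp only [mem_filter, mem_univ, true_and, mem_children]
      constructor
      · rintro ⟨⟨h1, -⟩, h2⟩; exact ⟨h1, h2⟩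
      · rintro ⟨h1, rfl⟩; exact ⟨⟨h1, hd⟩, rfl⟩
    · refine Finset.sum_eq_zero fun y hy => ?_
      simp only [mem_filter, mem_univ, true_and] at hy
      exact absurd (hy.2 ▸ hy.1.2) hd
  · intro y hy z hz hne
    simp only [coe_filter, mem_univ, true_and, Set.mem_ofPred_eq] at hy hz
    rw [Function.onFun, Finset.disjoint_left]
    intro k hk hk'
    simp only [mem_filter, mem_univ, true_and] at hk hk'
    exact hne (hk.child_unique hk' hy.1 hz.1)
  · simp only [mem_biUnion, mem_filter, mem_univ, true_and, not_exists, not_and]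
    intro y hy hr
    have := hr.le
    have := hy.1.lt
    omega

theorem treeSum_singleton (b : Fin 3) (f : Fin r → ℤ) (x : Fin r) :
    C.treeSum {b} f x = f x + ∑ y ∈ C.children x b, C.treeSum {b} f y := by
  classical
  rw [treeSum_eq]
  simp

theorem treeSum_compl {a b c : Fin 3} (hab : a ≠ b) (hac : a ≠ c) (hbc : b ≠ c)
    (f : Fin r → ℤ) (x : Fin r) :
    C.treeSum {a}ᶜ f x = f x + ∑ y ∈ C.children x b, C.treeSum {a}ᶜ f y
      + ∑ y ∈ C.children x c, C.treeSum {a}ᶜ f y := by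
  classical
  rw [treeSum_eq, sum_three hab hac hbc]
  simp [hab.symm, hac.symm]
  ring

theorem slotSum_eq (i : Fin r) (a : Fin 3) (f : Fin r → ℤ) :
    C.slotSum i a f = ∑ y ∈ C.children i a, C.treeSum {a}ᶜ f y :=
  C.sum_filter_reach _ (fun _ => C.slot_eq_some_iff) f

theorem sum_ite_slot (k l : Fin r) (z : ℤ) [Decidable (C.Prox k l)] :
    (∑ a, if C.slot k a = some l then z else 0) = if C.Prox k l then z else 0 := by
  split_ifs with h
  · obtain ⟨a, ha⟩ := C.prox_iff.1 h
    rw [Finset.sum_eq_single a]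
    · rw [if_pos ha]
    · exact fun b _ hb => if_neg fun e => hb (C.slot_inj e ha)
    · simp
  · exact Finset.sum_eq_zero fun a _ => if_neg fun e => h (C.prox_iff.2 ⟨a, e⟩)

theorem le_treeSum_of_pos (L : Set (Fin 3)) {f : Fin r → ℤ} (hf : ∀ k, 0 < f k) (x : Fin r) :
    f x ≤ C.treeSum L f x := by
  classical
  refine Finset.single_le_sum (f := f) (fun k _ => (hf k).le) ?_
  simpa using Reach.refl

end ToricConstellation

namespace ToricCluster

open ToricConstellation

variable {r : ℕ} (A : ToricCluster r)

theorem M_eq (i : Fin r) (a b : Fin 3) :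
    A.M i a b = ∑ y ∈ A.children i a, A.treeSum {b} A.m y :=
  A.sum_filter_reach _ (fun _ => A.inChain_iff) A.m

theorem sum_proxSet (i : Fin r) (f : Fin r → ℤ) :
    ∑ k ∈ A.proxSet i, f k = ∑ a, A.slotSum i a f := by
  simp only [proxSet, ToricConstellation.slotSum, Finset.sum_filter]
  rw [Finset.sum_comm]
  exact Finset.sum_congr rfl fun k _ => (A.sum_ite_slot k i (f k)).symm

theorem sum_Bset (k : Fin r) (f : Fin r → ℤ) :
    ∑ l ∈ A.Bset k, f l = ∑ a, (A.slot k a).elim 0 f := by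
  rw [Bset, Finset.sum_filter,
    Finset.sum_congr rfl fun l _ => (A.sum_ite_slot k l (f l)).symm, Finset.sum_comm]
  refine Finset.sum_congr rfl fun a _ => ?_
  cases h : A.slot k a <;> simp

theorem anteSet_eq (k : Fin r) : A.anteSet k = A.Bset k := by
  refine Finset.filter_congr fun l _ => and_iff_right_of_imp fun h => ?_
  obtain ⟨a, ha⟩ := A.prox_iff.1 h
  exact A.slot_lt ha

theorem N_eq (k : Fin r) : A.N k = A.m k + ∑ a, (A.slot k a).elim 0 A.N := by
  rw [N, Finset.sum_attach (A.anteSet k) A.N, anteSet_eq, sum_Bset]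

theorem nu_eq (k : Fin r) :
    A.nu k = 3 + ∑ a, (A.slot k a).elim 0 (fun l => A.nu l - 1) := by
  rw [nu, Finset.sum_attach (A.anteSet k) (fun l => A.nu l - 1), anteSet_eq, sum_Bset]

theorem N_pos (k : Fin r) : 0 < A.N k := by
  induction hn : (k : ℕ) using Nat.strong_induction_on generalizing k with
  | _ n ih =>
    rw [N_eq]
    refine add_pos_of_pos_of_nonneg (A.m_pos k) (Finset.sum_nonneg fun a _ => ?_)
    cases h : A.slot k a with
    | none => rfl
    | some l => exact (ih l (hn ▸ A.slot_lt h) l rfl).le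

theorem N_child {i y : Fin r} (hy : A.IsChild y i) (h : A.slot i (A.label y) = none) :
    A.N y = A.m y - A.m i + 2 * A.N i := by
  have : ∑ a, (A.slot y a).elim 0 A.N = ∑ a, (A.slot i a).elim 0 A.N + A.N i := by
    rw [← Finset.sum_erase_add _ _ (Finset.mem_univ (A.label y)),
      ← Finset.sum_erase_add _ _ (Finset.mem_univ (A.label y)), h, A.slot_child hy, if_pos rfl]
    simp only [Option.elim, add_zero]
    congr 1
    refine Finset.sum_congr rfl fun a ha => ?_
    rw [A.slot_child hy, if_neg (Finset.ne_of_mem_erase ha).symm]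
  rw [A.N_eq y, this, A.N_eq i]
  ring

theorem nu_child {i y : Fin r} (hy : A.IsChild y i) (h : A.slot i (A.label y) = none) :
    A.nu y = 2 * A.nu i - 1 := by
  have : ∑ a, (A.slot y a).elim 0 (fun l => A.nu l - 1) =
      ∑ a, (A.slot i a).elim 0 (fun l => A.nu l - 1) + (A.nu i - 1) := by
    rw [← Finset.sum_erase_add _ _ (Finset.mem_univ (A.label y)),
      ← Finset.sum_erase_add _ _ (Finset.mem_univ (A.label y)), h, A.slot_child hy, if_pos rfl]
    simp only [Option.elim, add_zero]
    congr 1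
    refine Finset.sum_congr rfl fun a ha => ?_
    rw [A.slot_child hy, if_neg (Finset.ne_of_mem_erase ha).symm]
  rw [A.nu_eq y, this, A.nu_eq i]
  ring

theorem sum_linProx {a b c : Fin 3} (hab : a ≠ b) (hac : a ≠ c) (hbc : b ≠ c)
    {i j : Fin r} (hj : A.slot j a = some i) :
    ∑ k ∈ (A.proxSet i).filter (fun k => LinProx A.toToricConstellation k j), A.m k =
      A.M j b c + A.M j c b := by
  rw [M, M, ← Finset.sum_union]
  · refine Finset.sum_congr ?_ fun _ _ => rfl
    ext k
    simp only [proxSet, mem_filter, mem_univ, true_and, mem_union]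
    exact A.prox_and_linProx_iff hab hac hbc hj
  · rw [Finset.disjoint_left]
    intro k hk hk'
    obtain ⟨y, hy, hl, hr⟩ := A.inChain_iff.1 (Finset.mem_filter.1 hk).2
    obtain ⟨z, hz, hl', hr'⟩ := A.inChain_iff.1 (Finset.mem_filter.1 hk').2
    rw [hr.child_unique hr' hy hz] at hl
    exact hbc (hl.symm.trans hl')

end ToricCluster

namespace ToricCluster

open ToricConstellation

variable {r : ℕ} (A : ToricCluster r)

theorem slotSum_add_rab {a b c : Fin 3} (hab : a ≠ b) (hac : a ≠ c) (hbc : b ≠ c) (i : Fin r) :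
    A.slotSum i a (fun j => A.m j + A.rab j b c) = A.M i a b + A.M i a c := by
  have key : ∀ x, A.treeSum {a}ᶜ (fun j => A.m j + A.rab j b c) x =
      A.treeSum {b} A.m x + A.treeSum {c} A.m x := by
    intro x
    induction x using A.child_induction with
    | step x ih =>
      have ih' : ∀ d, ∑ y ∈ A.children x d, A.treeSum {a}ᶜ (fun j => A.m j + A.rab j b c) y =
          ∑ y ∈ A.children x d, A.treeSum {b} A.m y +
            ∑ y ∈ A.children x d, A.treeSum {c} A.m y := by
        intro d
        rw [← Finset.sum_add_distrib]
        exact Finset.sum_congr rfl fun y hy => ih y (A.mem_children.1 hy).1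
      rw [A.treeSum_compl hab hac hbc, A.treeSum_singleton b, A.treeSum_singleton c,
        ih', ih', rab, M_eq, M_eq]
      ring
  rw [slotSum_eq, M_eq, M_eq, ← Finset.sum_add_distrib]
  exact Finset.sum_congr rfl fun y _ => key y

/-- The indicator of the condition that the label `d` does not appear under `Q_i`. -/
def free (i : Fin r) (d : Fin 3) : ℤ := if A.slot i d = none then 1 else 0

theorem card_Bset {a b c : Fin 3} (hab : a ≠ b) (hac : a ≠ c) (hbc : b ≠ c) (i : Fin r) :
    ((A.Bset i).card : ℤ) = (1 - A.free i a) + (1 - A.free i b) + (1 - A.free i c) := by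
  have h : ((A.Bset i).card : ℤ) = ∑ d, (1 - A.free i d) := by
    rw [Finset.cast_card, sum_Bset]
    refine Finset.sum_congr rfl fun d _ => ?_
    cases h : A.slot i d <;> simp [free, h]
  rw [h, sum_three hab hac hbc]

theorem sum_Bset_rab {a b c : Fin 3} (hab : a ≠ b) (hac : a ≠ c) (hbc : b ≠ c) (i : Fin r) :
    ∑ j ∈ A.Bset i, (A.m i - ∑ k ∈ (A.proxSet j).filter
          (fun k => LinProx A.toToricConstellation k i), A.m k) =
      (1 - A.free i a) * A.rab i b c + (1 - A.free i b) * A.rab i a c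
        + (1 - A.free i c) * A.rab i a b := by
  have key : ∀ {d e f : Fin 3}, d ≠ e → d ≠ f → e ≠ f →
      (A.slot i d).elim 0 (fun j => A.m i - ∑ k ∈ (A.proxSet j).filter
          (fun k => LinProx A.toToricConstellation k i), A.m k) =
        (1 - A.free i d) * A.rab i e f := by
    intro d e f hde hdf hef
    cases h : A.slot i d with
    | none => simp [free, h]
    | some j =>
      simp only [Option.elim, A.sum_linProx hde hdf hef h, rab, free, h]
      simp
      ring
  rw [sum_Bset, sum_three hab hac hbc, key hab hac hbc, key hab.symm hbc hac,
    key hac.symm hbc.symm hab]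

theorem sum_proxSet_rab {a b c : Fin 3} (hab : a ≠ b) (hac : a ≠ c) (hbc : b ≠ c) (i : Fin r) :
    ∑ j ∈ A.proxSet i, (A.m j + (A.m j - ∑ k ∈ (A.proxSet i).filter
          (fun k => LinProx A.toToricConstellation k j), A.m k)) =
      A.M i a b + A.M i a c + (A.M i b a + A.M i b c) + (A.M i c a + A.M i c b) := by
  have key : ∀ {d e f : Fin 3}, d ≠ e → d ≠ f → e ≠ f →
      A.slotSum i d (fun j => A.m j + (A.m j - ∑ k ∈ (A.proxSet i).filter
          (fun k => LinProx A.toToricConstellation k j), A.m k)) = A.M i d e + A.M i d f := by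
    intro d e f hde hdf hef
    rw [← A.slotSum_add_rab hde hdf hef]
    refine Finset.sum_congr rfl fun j hj => ?_
    simp only [A.sum_linProx hde hdf hef (Finset.mem_filter.1 hj).2, rab]
    ring
  rw [sum_proxSet, sum_three hab hac hbc, key hab hac hbc, key hab.symm hbc hac,
    key hac.symm hbc.symm hab]

theorem card_Aset {a b c : Fin 3} (hab : a ≠ b) (hac : a ≠ c) (hbc : b ≠ c) (i : Fin r) :
    ((A.Aset i).card : ℤ) = (A.children i a).card * (A.free i b * A.free i c)
      + (A.children i b).card * (A.free i a * A.free i c)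
      + (A.children i c).card * (A.free i a * A.free i b) := by
  have hmem : ∀ k, k ∈ A.Aset i ↔
      A.IsChild k i ∧ ∀ x, x ≠ A.label k → A.slot i x = none := by
    intro k
    simp only [Aset, mem_filter, mem_univ, true_and]
    refine and_congr_right fun hk => ?_
    constructor
    · intro h x hx
      by_contra hne
      obtain ⟨l, hl⟩ := Option.ne_none_iff_exists'.1 hne
      refine h ⟨l, A.prox_iff.2 ⟨x, hl⟩, A.prox_iff.2 ⟨x, ?_⟩⟩
      rw [A.slot_child hk, if_neg hx.symm, hl]
    · rintro h ⟨l, hil, hkl⟩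
      obtain ⟨x, hx⟩ := A.prox_iff.1 hkl
      rw [A.slot_child hk] at hx
      split_ifs at hx with e
      · cases hx
        exact hil.1 rfl
      · rw [h x (Ne.symm e)] at hx
        cases hx
  have key : ∀ {d e f : Fin 3}, d ≠ e → d ≠ f → e ≠ f →
      ∑ k ∈ A.Aset i with A.label k = d, (1 : ℤ) =
        (A.children i d).card * (A.free i e * A.free i f) := by
    intro d e f hde hdf hef
    by_cases h : A.slot i e = none ∧ A.slot i f = none
    · have : {k ∈ A.Aset i | A.label k = d} = A.children i d := by
        ext k
        rw [mem_filter, hmem, mem_children]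
        constructor
        · exact fun hk => ⟨hk.1.1, hk.2⟩
        · rintro ⟨hk, rfl⟩
          refine ⟨⟨hk, fun x hx => ?_⟩, rfl⟩
          rcases eq_of_ne hde hdf hef x with rfl | rfl | rfl
          · exact absurd rfl hx
          · exact h.1
          · exact h.2
      rw [this]
      simp [free, h.1, h.2]
    · rw [Finset.sum_eq_zero]
      · rcases not_and_or.1 h with h | h <;> simp [free, h]
      · intro k hk
        rw [mem_filter, hmem] at hk
        obtain ⟨hk, rfl⟩ := hk
        exact absurd ⟨hk.2 e hde.symm, hk.2 f hdf.symm⟩ h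
  rw [Finset.cast_card, ← Finset.sum_fiberwise _ A.label, sum_three hab hac hbc,
    key hab hac hbc, key hab.symm hbc hac, key hac.symm hbc.symm hab]

theorem free_cases (i : Fin r) (d : Fin 3) : A.free i d = 0 ∨ A.free i d = 1 := by
  unfold free
  split_ifs <;> simp

theorem chi_eq {a b c : Fin 3} (hab : a ≠ b) (hac : a ≠ c) (hbc : b ≠ c) (i : Fin r) :
    A.chi i = A.D i
      + A.free i b * A.free i c * (1 - (A.children i a).card)
      + A.free i a * A.free i c * (1 - (A.children i b).card)
      + A.free i a * A.free i b * (1 - (A.children i c).card)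
      - A.free i c * A.rab i a b - A.free i b * A.rab i a c - A.free i a * A.rab i b c := by
  have h1 := A.sum_proxSet_rab hab hac hbc i
  have h2 : ∑ j ∈ A.proxSet i, A.m j * (A.m j - 1) =
      ∑ j ∈ A.proxSet i, A.m j ^ 2 - ∑ j ∈ A.proxSet i, A.m j := by
    rw [← Finset.sum_sub_distrib]
    exact Finset.sum_congr rfl fun _ _ => by ring
  rw [Finset.sum_add_distrib] at h1
  have hT : 3 - ((A.Aset i).card : ℤ) - 2 * ((A.Bset i).card : ℤ)
      + (((A.Bset i).card.choose 2 : ℕ) : ℤ) =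
      A.free i b * A.free i c * (1 - (A.children i a).card)
      + A.free i a * A.free i c * (1 - (A.children i b).card)
      + A.free i a * A.free i b * (1 - (A.children i c).card) := by
    have hB := A.card_Bset hab hac hbc i
    rw [A.card_Aset hab hac hbc]
    rcases A.free_cases i a with ha | ha <;> rcases A.free_cases i b with hb | hb <;>
      rcases A.free_cases i c with hc | hc <;> rw [ha, hb, hc] at hB ⊢
    all_goals
      obtain h | h | h | h : (A.Bset i).card = 0 ∨ (A.Bset i).card = 1 ∨
        (A.Bset i).card = 2 ∨ (A.Bset i).card = 3 := by omega
    all_goals first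
      | exfalso; omega
      | rw [h]; norm_num [Nat.choose]; try ring
  rw [chi, A.sum_Bset_rab hab hac hbc, h2, D]
  simp only [rab] at *
  linear_combination h1 + hT

section inequalities

variable {A} {a b c : Fin 3} {i : Fin r}

theorem M_nonneg : 0 ≤ A.M i a b :=
  Finset.sum_nonneg fun k _ => (A.m_pos k).le

theorem le_treeSum (L : Set (Fin 3)) (x : Fin r) : A.m x ≤ A.treeSum L A.m x :=
  A.le_treeSum_of_pos L A.m_pos x

/-- A lower bound for the defect in the inequality between the area under the Newton polygon of
a planar cluster and the product of its intercepts. -/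
theorem Idealistic.treeSum_sq_le (hA : A.Idealistic) (hab : a ≠ b) (hac : a ≠ c) (hbc : b ≠ c)
    (x : Fin r) :
    A.treeSum {a}ᶜ (fun k => A.m k ^ 2) x ≤ A.m x ^ 2
      + (A.treeSum {b} A.m x - A.m x) * A.M x b c
      + (A.treeSum {c} A.m x - A.m x) * A.M x c b := by
  induction x using A.child_induction with
  | step x ih =>
    have key : ∀ d, ∑ y ∈ A.children x d, A.treeSum {a}ᶜ (fun k => A.m k ^ 2) y ≤
        (∑ y ∈ A.children x d, A.treeSum {b} A.m y) *
          ∑ y ∈ A.children x d, A.treeSum {c} A.m y := by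
      intro d
      rcases A.children_cases x d with h | ⟨y, hy, -, h⟩
      · simp [h]
      · simp only [h, Finset.sum_singleton]
        have h1 := ih y hy
        have h2 := hA y b c hbc
        have h3 := M_nonneg (A := A) (i := y) (a := b) (b := c)
        have h4 := M_nonneg (A := A) (i := y) (a := c) (b := b)
        have h5 := A.m_pos y
        have h6 := le_treeSum (A := A) {b} y
        have h7 := le_treeSum (A := A) {c} y
        nlinarith [mul_nonneg (sub_nonneg.2 h6) (sub_nonneg.2 h7),
          mul_nonneg (sub_nonneg.2 h6) h4, mul_nonneg (sub_nonneg.2 h7) h3,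
          mul_nonneg (sub_nonneg.2 h6) (sub_nonneg.2 h2),
          mul_nonneg (sub_nonneg.2 h7) (sub_nonneg.2 h2)]
    have hb := key b
    have hc := key c
    have eb := A.treeSum_singleton b A.m x
    have ec := A.treeSum_singleton c A.m x
    rw [A.treeSum_compl hab hac hbc, M_eq, M_eq, eb, ec]
    linarith

end inequalities

end ToricCluster

namespace ToricCluster

open ToricConstellation

section arithmetic

variable {m D x z y u w v : ℤ}

theorem mul_rab_le (hm : 0 < m) (hD : m ^ 2 - x * z - y * u - w * v ≤ D) :
    m * (z * (m - x - y) + v * (m - z - w) + y * (m - u - v)) + z * v * y +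
      (m - z) * (m - v) * (m - y) ≤ m * D := by
  nlinarith [mul_le_mul_of_nonneg_left hD hm.le]

theorem rab_le (hm : 0 < m) (hD : m ^ 2 - x * z - y * u - w * v ≤ D)
    (hx : 0 ≤ x) (hz : 0 ≤ z) (hy : 0 ≤ y) (hu : 0 ≤ u) (hw : 0 ≤ w) (hv : 0 ≤ v)
    (hab : x + y ≤ m) (hac : z + w ≤ m) (hbc : u + v ≤ m) :
    z * (m - x - y) ≤ D := by
  have h := mul_rab_le hm hD
  have h1 : 0 ≤ v * (m - z - w) := mul_nonneg hv (by linarith)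
  have h2 : 0 ≤ y * (m - u - v) := mul_nonneg hy (by linarith)
  have h3 : 0 ≤ z * v * y := by positivity
  have h4 : 0 ≤ (m - z) * (m - v) * (m - y) :=
    mul_nonneg (mul_nonneg (by linarith) (by linarith)) (by linarith)
  have h5 := mul_nonneg hm.le h1
  have h6 := mul_nonneg hm.le h2
  refine le_of_mul_le_mul_left ?_ hm
  linarith

theorem corner_le (hD : m ^ 2 - x * z - y * u - w * v ≤ D) (hv : 0 ≤ v) (hy : 0 ≤ y)
    (hbc : u + v ≤ m) (hyw : w ≤ y) :
    x * (m - z) + m * (m - x - y) ≤ D := by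
  nlinarith [mul_nonneg hv (sub_nonneg.2 hyw), mul_nonneg hy (sub_nonneg.2 hbc)]

theorem full_or_mul_le (hw : 0 ≤ w) (hv : 0 ≤ v) (hwm : w ≤ m) (hvm : v ≤ m) :
    (w = m ∧ v = m) ∨ w * v ≤ m * (m - 1) := by
  rcases hwm.lt_or_eq with h | rfl
  · right
    calc w * v ≤ (m - 1) * m := mul_le_mul (by omega) hvm hv (by omega)
      _ = _ := by ring
  rcases hvm.lt_or_eq with h | rfl
  · right
    exact mul_le_mul_of_nonneg_left (by omega) hw
  · exact .inl ⟨rfl, rfl⟩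

theorem full_of_two_labels (hm : 0 < m) (hD : m ^ 2 - x * z - y * u - w * v ≤ D)
    (ha : x = 0 ∧ z = 0 ∨ 1 ≤ x ∧ 1 ≤ z) (hb : y = 0 ∧ u = 0 ∨ 1 ≤ y ∧ 1 ≤ u)
    (hw : 0 ≤ w) (hv : 0 ≤ v)
    (hab : x + y ≤ m) (hac : z + w ≤ m) (hbc : u + v ≤ m) (hχ : D < m - x - y) :
    w = m ∧ v = m ∧ D < m := by
  rcases ha with ⟨rfl, rfl⟩ | ⟨hx, hz⟩
  · rcases hb with ⟨rfl, rfl⟩ | ⟨hy, hu⟩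
    · rcases full_or_mul_le (m := m) hw hv (by linarith) (by linarith) with ⟨h1, h2⟩ | h
      · exact ⟨h1, h2, by linarith⟩
      · nlinarith
    · have h := rab_le (x := y) (z := u) (y := 0) (u := 0) (w := v) (v := w) hm
        (by linarith) (by linarith) (by linarith) le_rfl le_rfl hv hw (by linarith) hbc
        (by linarith)
      nlinarith
  · have h := rab_le hm hD (by linarith) (by linarith) (by omega) (by omega) hw hv hab hac hbc
    nlinarith

theorem full_of_one_label {e : ℤ} (hm : 0 < m) (hD : m ^ 2 - x * z - y * u - w * v ≤ D)
    (ha : e = 0 ∧ x = 0 ∧ z = 0 ∨ e = 1 ∧ 1 ≤ x ∧ 1 ≤ z)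
    (hb : y = 0 ∧ u = 0 ∨ 1 ≤ y ∧ 1 ≤ u) (hc : w = 0 ∧ v = 0 ∨ 1 ≤ w ∧ 1 ≤ v)
    (hab : x + y ≤ m) (hac : z + w ≤ m) (hbc : u + v ≤ m)
    (hχ : D + (1 - e) - (m - x - y) - (m - z - w) < 0) :
    ((w = m ∧ v = m) ∨ (y = m ∧ u = m)) ∧ D < m := by
  rcases ha with ⟨rfl, rfl, rfl⟩ | ⟨rfl, hx, hz⟩
  · rcases hb with ⟨rfl, rfl⟩ | ⟨hy, hu⟩
    · rcases full_or_mul_le (m := m) (w := w) (v := v) (by omega) (by omega) (by linarith)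
        (by linarith) with ⟨h1, h2⟩ | h
      · exact ⟨.inl ⟨h1, h2⟩, by linarith⟩
      · exfalso
        have h0 : w * v ≤ w * m := mul_le_mul_of_nonneg_left (by linarith) (by omega)
        rcases (show w ≤ m by linarith).lt_or_eq with h3 | h3
        · nlinarith [mul_nonneg (show 0 ≤ m - 1 by omega) (show 0 ≤ m - w - 1 by omega)]
        · subst h3
          nlinarith
    · rcases hc with ⟨rfl, rfl⟩ | ⟨hw, hv⟩
      · rcases full_or_mul_le (m := m) (w := y) (v := u) (by omega) (by omega) (by linarith)
          (by linarith) with ⟨h1, h2⟩ | h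
        · exact ⟨.inr ⟨h1, h2⟩, by linarith⟩
        · exfalso
          have h0 : y * u ≤ y * m := mul_le_mul_of_nonneg_left (by linarith) (by omega)
          rcases (show y ≤ m by linarith).lt_or_eq with h3 | h3
          · nlinarith [mul_nonneg (show 0 ≤ m - 1 by omega) (show 0 ≤ m - y - 1 by omega)]
          · subst h3
            nlinarith
      · exfalso
        have h1 : w * v ≤ w * (m - u) := mul_le_mul_of_nonneg_left (by linarith) (by omega)
        nlinarith [mul_nonneg (show 0 ≤ m - y by linarith) (show 0 ≤ u - 1 by linarith),
          mul_nonneg (show 0 ≤ m - w by linarith) (show 0 ≤ m - u - 1 by linarith)]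
  · exfalso
    have hy0 : 0 ≤ y := by omega
    have hu0 : 0 ≤ u := by omega
    have hw0 : 0 ≤ w := by omega
    have hv0 : 0 ≤ v := by omega
    rcases le_total w y with h | h
    · have h1 := corner_le hD (by omega) (by omega) hbc h
      nlinarith [mul_nonneg (show 0 ≤ x - 1 by omega) (show 0 ≤ m - z by omega),
        mul_nonneg (show 0 ≤ m - 1 by omega) (show 0 ≤ m - x - y by omega)]
    · have h1 := corner_le (m := m) (D := D) (x := z) (z := x) (y := w) (u := v) (w := y)
        (v := u) (by linarith) (by omega) (by omega) (by linarith) h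
      nlinarith [mul_nonneg (show 0 ≤ z - 1 by omega) (show 0 ≤ m - x by omega),
        mul_nonneg (show 0 ≤ m - 1 by omega) (show 0 ≤ m - z - w by omega)]

theorem root_two_children (hm : 0 < m) (hD : m ^ 2 - x * z - y * u ≤ D)
    (hx : 1 ≤ x) (hy : 1 ≤ y)
    (hab : x + y ≤ m) (hac : z ≤ m) (hbc : u ≤ m) :
    0 < D + 1 - (m - x - y) - (m - z) - (m - u) := by
  nlinarith [mul_nonneg (show 0 ≤ x - 1 by omega) (show 0 ≤ m - z by omega),
    mul_nonneg (show 0 ≤ y - 1 by omega) (show 0 ≤ m - u by omega),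
    mul_nonneg (show 0 ≤ m - 1 by omega) (show 0 ≤ m - x - y by omega)]

theorem root_one_child (hm : 0 < m) (hD : m ^ 2 - x * z ≤ D)
    (hx : 1 ≤ x) (hab : x ≤ m) (hac : z ≤ m)
    (hχ : D + 2 - (m - x) - (m - z) - m ≤ 0) : x = m ∧ z = m ∧ D < m := by
  rcases hab.lt_or_eq with h | rfl
  · nlinarith [mul_nonneg (show 0 ≤ x - 1 by omega) (show 0 ≤ m - z by omega),
      mul_nonneg (show 0 ≤ m - 1 by omega) (show 0 ≤ m - 1 - x by omega)]
  rcases hac.lt_or_eq with h | rfl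
  · nlinarith [mul_nonneg (show 0 ≤ x - 1 by omega) (show 0 ≤ x - z by omega),
      mul_nonneg (show 0 ≤ x - 1 by omega) (show 0 ≤ x - 1 - z by omega)]
  · exact ⟨rfl, rfl, by linarith⟩

theorem root_three_children (hm : 0 < m) (hD : m ^ 2 - x * z - y * u - w * v ≤ D)
    (hx : 1 ≤ x) (hz : 1 ≤ z) (hy : 1 ≤ y) (hu : 1 ≤ u) (hw : 1 ≤ w) (hv : 1 ≤ v)
    (hab : x + y ≤ m) (hac : z + w ≤ m) (hbc : u + v ≤ m) :
    0 < D - (m - x - y) - (m - z - w) - (m - u - v) := by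
  have h := mul_rab_le hm hD
  have h0 : (m - x - y) ≤ z * (m - x - y) := le_mul_of_one_le_left (by linarith) hz
  have h1 : (m - z - w) ≤ v * (m - z - w) := le_mul_of_one_le_left (by linarith) hv
  have h2 : (m - u - v) ≤ y * (m - u - v) := le_mul_of_one_le_left (by linarith) hy
  have h3 : 0 < z * v * y := by positivity
  have h4 : 0 ≤ (m - z) * (m - v) * (m - y) :=
    mul_nonneg (mul_nonneg (by linarith) (by linarith)) (by linarith)
  have h5 := mul_le_mul_of_nonneg_left (add_le_add (add_le_add h0 h1) h2) hm.le
  refine pos_of_mul_pos_right (a := m) ?_ hm.le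
  linarith

theorem full_of_no_label {e f g : ℤ} (hm : 0 < m)
    (hD : m ^ 2 - x * z - y * u - w * v ≤ D)
    (ha : e = 0 ∧ x = 0 ∧ z = 0 ∨ e = 1 ∧ 1 ≤ x ∧ 1 ≤ z)
    (hb : f = 0 ∧ y = 0 ∧ u = 0 ∨ f = 1 ∧ 1 ≤ y ∧ 1 ≤ u)
    (hc : g = 0 ∧ w = 0 ∧ v = 0 ∨ g = 1 ∧ 1 ≤ w ∧ 1 ≤ v)
    (hab : x + y ≤ m) (hac : z + w ≤ m) (hbc : u + v ≤ m)
    (hχ : D + (1 - e) + (1 - f) + (1 - g) - (m - x - y) - (m - z - w) - (m - u - v) ≤ 0) :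
    ((x = m ∧ z = m) ∨ (y = m ∧ u = m) ∨ (w = m ∧ v = m)) ∧ D < m := by
  rcases ha with ⟨rfl, rfl, rfl⟩ | ⟨rfl, hx, hz⟩ <;>
    rcases hb with ⟨rfl, rfl, rfl⟩ | ⟨rfl, hy, hu⟩ <;>
    rcases hc with ⟨rfl, rfl, rfl⟩ | ⟨rfl, hw, hv⟩
  · nlinarith [sq_nonneg (m - 1)]
  · have := root_one_child (m := m) (D := D) (x := w) (z := v) hm
      (by linarith) hw (by linarith) (by linarith) (by linarith)
    exact ⟨.inr (.inr ⟨this.1, this.2.1⟩), this.2.2⟩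
  · have := root_one_child (m := m) (D := D) (x := y) (z := u) hm
      (by linarith) hy (by linarith) (by linarith) (by linarith)
    exact ⟨.inr (.inl ⟨this.1, this.2.1⟩), this.2.2⟩
  · have := root_two_children (m := m) (D := D) (x := u) (z := y) (y := v) (u := w) hm
      (by linarith) hu hv (by linarith) (by linarith) (by linarith)
    linarith
  · have := root_one_child (m := m) (D := D) (x := x) (z := z) hm
      (by linarith) hx (by linarith) (by linarith) (by linarith)
    exact ⟨.inl ⟨this.1, this.2.1⟩, this.2.2⟩
  · have := root_two_children (m := m) (D := D) (x := z) (z := x) (y := w) (u := v) hm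
      (by linarith) hz hw (by linarith) (by linarith) (by linarith)
    linarith
  · have := root_two_children (m := m) (D := D) (x := x) (z := z) (y := y) (u := u) hm
      (by linarith) hx hy (by linarith) (by linarith) (by linarith)
    linarith
  · have := root_three_children hm hD hx hz hy hu hw hv hab hac hbc
    linarith

theorem corner_eq_one (hD : m ^ 2 - x * z - y * u - w * v ≤ D)
    (hx : 1 ≤ x) (hz : 2 ≤ z) (hy : 0 ≤ y) (hu : 0 ≤ u) (hw : 0 ≤ w) (hv : 0 ≤ v)
    (hab : x + y ≤ m) (hac : z + w ≤ m) (hbc : u + v ≤ m)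
    (hχ : D = (m - x - y) + (m - z - w)) (hpos : 0 < D) : x = 1 := by
  rcases le_total w y with h | h
  · have h1 := corner_le hD hv hy hbc h
    have h2 : m - x - y = 0 := by
      nlinarith [mul_nonneg (show 0 ≤ x - 1 by omega) (show 0 ≤ m - z by omega),
        mul_nonneg (show 0 ≤ m - 2 by omega) (show 0 ≤ m - x - y by omega)]
    rw [h2] at h1
    by_contra hne
    nlinarith [mul_nonneg (show 0 ≤ x - 2 by omega) (show 0 ≤ m - z by omega)]
  · have h1 := corner_le (m := m) (D := D) (x := z) (z := x) (y := w) (u := v) (w := y)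
      (v := u) (by linarith) hu hw (by linarith) h
    nlinarith [mul_nonneg (show 0 ≤ z - 2 by omega) (show 0 ≤ m - x by omega),
      mul_nonneg (show 0 ≤ m - 2 by omega) (show 0 ≤ m - z - w by omega)]

theorem opposite_corner {e : ℤ} (hm : 0 < m) (hD : m ^ 2 - x * z - y * u - w * v ≤ D)
    (hx : 1 ≤ x) (hz : 2 ≤ z)
    (hb : e = 0 ∧ y = 0 ∧ u = 0 ∨ e = 1 ∧ 1 ≤ y ∧ 1 ≤ u)
    (hc : w = 0 ∧ v = 0 ∨ 1 ≤ w ∧ 1 ≤ v)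
    (hab : x + y ≤ m) (hac : z + w ≤ m) (hbc : u + v ≤ m)
    (hχ : D + (1 - e) = (m - x - y) + (m - u - v)) (hpos : 0 < D) :
    (x = m ∧ z = m ∧ D < m) ∨ (x = m - 1 ∧ z = m ∧ D ≤ m ^ 2 - x * z - y * u - w * v) := by
  rcases hb with ⟨rfl, rfl, rfl⟩ | ⟨rfl, hy, hu⟩
  · have hzm : z = m := by
      by_contra hne
      have h1 : w * v ≤ (m - z) * v := mul_le_mul_of_nonneg_right (by linarith) (by omega)
      nlinarith [mul_nonneg (show 0 ≤ m - x by omega) (show 0 ≤ z - 2 by omega),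
        mul_nonneg (show 0 ≤ m - v by omega) (show 0 ≤ m - z - 1 by omega)]
    subst hzm
    obtain ⟨rfl, rfl⟩ : w = 0 ∧ v = 0 := by omega
    have h1 : z - x ≤ 1 := by nlinarith
    rcases (show x = z ∨ x = z - 1 by omega) with rfl | rfl
    · exact .inl ⟨rfl, rfl, by linarith⟩
    · exact .inr ⟨rfl, rfl, by nlinarith⟩
  · right
    have h0 := rab_le hm hD (by linarith) (by linarith) (by omega) (by omega) (by omega)
      (by omega) hab hac hbc
    rcases le_total v x with h | h
    · have hv0 : 0 ≤ v := by omega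
      have hw0 : 0 ≤ w := by omega
      have h1 := corner_le (m := m) (D := D) (x := y) (z := u) (y := x) (u := z) (w := v)
        (v := w) (by linarith) (by omega) (by omega) hac h
      have h2 : m - x - y = 0 := by
        nlinarith [mul_nonneg (show 0 ≤ y - 1 by omega) (show 0 ≤ m - u by omega),
          mul_nonneg (show 0 ≤ m - 2 by omega) (show 0 ≤ m - x - y by omega)]
      have h3 : y = 1 := by
        by_contra hne
        nlinarith [mul_nonneg (show 0 ≤ y - 2 by omega) (show 0 ≤ m - u by omega)]
      subst h3
      obtain rfl : x = m - 1 := by linarith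
      have h4 : w = 0 ∧ v = 0 := by
        refine hc.resolve_right fun ⟨hw, hv⟩ => ?_
        nlinarith [mul_nonneg (show 0 ≤ v by omega) (show 0 ≤ m - z - w by omega),
          mul_nonneg (show 0 ≤ m - 1 - v by omega) (show 0 ≤ m - z - 1 by omega)]
      obtain ⟨rfl, rfl⟩ := h4
      have h5 : z = m := by
        by_contra hne
        nlinarith [mul_nonneg (show 0 ≤ m - 1 by omega) (show 0 ≤ m - z - 1 by omega)]
      subst h5
      exact ⟨rfl, rfl, by nlinarith⟩
    · exfalso
      have h1 := corner_le (m := m) (D := D) (x := u) (z := y) (y := v) (u := w) (w := x)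
        (v := z) (by linarith) (by omega) (by omega) (by linarith) h
      nlinarith [mul_nonneg (show 0 ≤ u - 1 by omega) (show 0 ≤ m - y by omega),
        mul_nonneg (show 0 ≤ m - 2 by omega) (show 0 ≤ m - u - v by omega),
        mul_nonneg (show 0 ≤ z - 2 by omega) (show 0 ≤ m - x - y by omega)]

end arithmetic

end ToricCluster

namespace ToricConstellation

variable {r : ℕ} {C : ToricConstellation r}

theorem exists_third {a c : Fin 3} (h : a ≠ c) : ∃ b, a ≠ b ∧ b ≠ c := by
  revert a c
  decide

theorem Reach.of_slot_eq_none {L : Set (Fin 3)} {x k : Fin r} {c : Fin 3}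
    (h : C.Reach L x k) (hc : C.slot k c = none) :
    C.slot x c = none ∧ C.Reach (L \ {c}) x k := by
  induction h with
  | refl => exact ⟨hc, .refl⟩
  | step k hk hl _ ih =>
    rw [C.slot_of_pos hk] at hc
    split_ifs at hc with e
    exact ⟨(ih hc).1, .step k hk ⟨hl, e⟩ (ih hc).2⟩

end ToricConstellation

namespace ToricCluster

open ToricConstellation

variable {r : ℕ} {A : ToricCluster r} {a b c : Fin 3} {i j k x y : Fin r}

theorem children_eq_singleton (hx : A.IsChild x i) (ha : A.label x = a) :
    A.children i a = {x} := by
  ext z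
  rw [mem_children, Finset.mem_singleton]
  constructor
  · exact fun hz => A.child_eq hz.1 hx (hz.2.trans ha.symm)
  · rintro rfl
    exact ⟨hx, ha⟩

theorem M_of_child (hx : A.IsChild x i) (ha : A.label x = a) :
    A.M i a b = A.treeSum {b} A.m x := by
  rw [M_eq, children_eq_singleton hx ha, Finset.sum_singleton]

theorem card_children_cases (A : ToricCluster r) (i : Fin r) (a b c : Fin 3) :
    ((A.children i a).card : ℤ) = 0 ∧ A.M i a b = 0 ∧ A.M i a c = 0 ∨
      ((A.children i a).card : ℤ) = 1 ∧ 1 ≤ A.M i a b ∧ 1 ≤ A.M i a c := by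
  rcases A.children_cases i a with h | ⟨y, hy, hl, h⟩
  · left
    simp [M_eq, h]
  · right
    have h1 := A.m_pos y
    have h2 := le_treeSum (A := A) {b} y
    have h3 := le_treeSum (A := A) {c} y
    rw [M_of_child hy hl, M_of_child hy hl, h]
    refine ⟨by simp, by linarith, by linarith⟩

theorem children_eq_empty (h : A.M i a b ≤ 0) : A.children i a = ∅ := by
  rcases A.card_children_cases i a b b with h1 | h1
  · simpa using h1.1
  · omega

theorem add_le_treeSum (hy : A.IsChild y x) (hl : A.label y = b) :
    A.m x + A.m y ≤ A.treeSum {b} A.m x := by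
  rw [treeSum_singleton, children_eq_singleton hy hl, Finset.sum_singleton]
  linarith [le_treeSum (A := A) {b} y]

theorem children_eq_empty_of_treeSum (h : A.treeSum {b} A.m x ≤ A.m x) :
    A.children x b = ∅ := by
  rcases A.children_cases x b with h1 | ⟨y, hy, hl, -⟩
  · exact h1
  · have := add_le_treeSum hy hl
    have := A.m_pos y
    omega

theorem D_eq (hab : a ≠ b) (hac : a ≠ c) (hbc : b ≠ c) (i : Fin r) :
    A.D i = A.m i ^ 2 - A.slotSum i a (fun k => A.m k ^ 2)
      - A.slotSum i b (fun k => A.m k ^ 2) - A.slotSum i c (fun k => A.m k ^ 2) := by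
  rw [D, sum_proxSet, sum_three hab hac hbc]
  ring

namespace Idealistic

theorem mul_defect (hA : A.Idealistic) (hab : a ≠ b) (hac : a ≠ c) (hbc : b ≠ c) (x : Fin r) :
    (A.treeSum {b} A.m x - A.m x) * (A.m x - A.M x b c)
      + (A.treeSum {c} A.m x - A.m x) * (A.m x - A.M x c b)
      + (A.treeSum {b} A.m x - A.m x) * (A.treeSum {c} A.m x - A.m x) ≤
    A.treeSum {b} A.m x * A.treeSum {c} A.m x - A.treeSum {a}ᶜ (fun k => A.m k ^ 2) x := by
  linarith [hA.treeSum_sq_le hab hac hbc x]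

theorem slotSum_sq_le (hA : A.Idealistic) (hab : a ≠ b) (hac : a ≠ c) (hbc : b ≠ c)
    (i : Fin r) : A.slotSum i a (fun k => A.m k ^ 2) ≤ A.M i a b * A.M i a c := by
  rw [slotSum_eq, M_eq, M_eq]
  rcases A.children_cases i a with h | ⟨x, hx, -, h⟩
  · simp [h]
  · simp only [h, Finset.sum_singleton]
    have h1 := hA.mul_defect hab hac hbc x
    have h2 := hA x b c hbc
    have h3 := M_nonneg (A := A) (i := x) (a := b) (b := c)
    have h4 := M_nonneg (A := A) (i := x) (a := c) (b := b)
    have h5 := sub_nonneg.2 (le_treeSum (A := A) {b} x)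
    have h6 := sub_nonneg.2 (le_treeSum (A := A) {c} x)
    have h7 := mul_nonneg h5 (show 0 ≤ A.m x - A.M x b c by linarith)
    have h8 := mul_nonneg h6 (show 0 ≤ A.m x - A.M x c b by linarith)
    have h9 := mul_nonneg h5 h6
    linarith

theorem le_D (hA : A.Idealistic) (hab : a ≠ b) (hac : a ≠ c) (hbc : b ≠ c) (i : Fin r) :
    A.m i ^ 2 - A.M i a b * A.M i a c - A.M i b a * A.M i b c - A.M i c a * A.M i c b ≤
      A.D i := by
  rw [D_eq hab hac hbc]
  linarith [hA.slotSum_sq_le hab hac hbc i, hA.slotSum_sq_le hab.symm hbc hac i,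
    hA.slotSum_sq_le hac.symm hbc.symm hab i]

theorem m_child_le (hA : A.Idealistic) (hy : A.IsChild y x) : A.m y ≤ A.m x := by
  obtain ⟨e, he⟩ := exists_ne (A.label y)
  have h1 := hA x (A.label y) e he.symm
  have h2 := M_nonneg (A := A) (i := x) (a := e) (b := A.label y)
  have h3 := le_treeSum (A := A) {e} y
  rw [M_of_child hy rfl] at h1
  linarith

theorem m_le_of_reach (hA : A.Idealistic) {L : Set (Fin 3)} (h : A.Reach L x k) :
    A.m k ≤ A.m x := by
  induction h with
  | refl => exact le_rfl
  | step k hk _ _ ih => exact (hA.m_child_le ⟨hk, rfl⟩).trans ih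

/-- If all the weight of `Q_i` is passed on in the direction `a`, then the only node proximate
to `Q_i` is its child with label `a`. -/
theorem prox_iff_of_full (hA : A.Idealistic) (h : ∀ e ≠ a, A.M i a e = A.m i)
    (hD : A.D i < A.m i) :
    ∃ y, A.IsChild y i ∧ A.label y = a ∧ A.m y = A.m i ∧ ∀ k, A.Prox k i ↔ k = y := by
  obtain ⟨b, c, hab, hac, hbc⟩ : ∃ b c : Fin 3, a ≠ b ∧ a ≠ c ∧ b ≠ c := by
    obtain ⟨c, hc⟩ := exists_ne a
    obtain ⟨b, hb⟩ := exists_third hc.symm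
    exact ⟨b, c, hb.1, hc.symm, hb.2⟩
  have hb := h b hab.symm
  have hc := h c hac.symm
  have hm := A.m_pos i
  have eb : A.children i b = ∅ := children_eq_empty (b := a) (by linarith [hA i a b hab])
  have ec : A.children i c = ∅ := children_eq_empty (b := a) (by linarith [hA i a c hac])
  rcases A.children_cases i a with ha | ⟨y, hy, hl, ha⟩
  · simp [M_eq, ha] at hb
    omega
  rw [M_of_child hy hl] at hb hc
  rw [D_eq hab hac hbc, slotSum_eq, slotSum_eq, slotSum_eq, ha, eb, ec] at hD
  simp only [Finset.sum_singleton, Finset.sum_empty] at hD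
  have h1 := hA.mul_defect hab hac hbc y
  have h2 := hA y b c hbc
  have h3 := le_treeSum (A := A) {b} y
  have hmy : A.m y = A.m i := by
    rw [hb, hc] at h1
    rw [hb] at h3
    by_contra hne
    have h4 : 1 ≤ A.m i - A.m y := by omega
    nlinarith [mul_le_mul_of_nonneg_right h4 hm.le, mul_nonneg (show 0 ≤ A.m i - A.m y by omega)
      (show 0 ≤ A.m y - A.M y b c - A.M y c b by linarith)]
  have fb : A.children y b = ∅ := children_eq_empty_of_treeSum (by omega)
  have fc : A.children y c = ∅ := children_eq_empty_of_treeSum (by omega)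
  refine ⟨y, hy, hl, hmy, fun k => ?_⟩
  rw [A.prox_iff]
  constructor
  · rintro ⟨d, hd⟩
    obtain ⟨z, hz, hzd, hr⟩ := A.slot_eq_some_iff.1 hd
    have hz' : z ∈ A.children i d := A.mem_children.2 ⟨hz, hzd⟩
    rcases eq_of_ne hab hac hbc d with rfl | rfl | rfl
    · rw [ha, Finset.mem_singleton] at hz'
      subst hz'
      rcases hr.eq_or_child with h | ⟨w, hw, hwl, -⟩
      · exact h
      · have hw' : w ∈ A.children z (A.label w) := A.mem_children.2 ⟨hw, rfl⟩
        rcases eq_of_ne hab hac hbc (A.label w) with h | h | h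
        · exact absurd h hwl
        · simp [h, fb] at hw'
        · simp [h, fc] at hw'
    · simp [eb] at hz'
    · simp [ec] at hz'
  · rintro rfl
    exact ⟨a, A.slot_eq_some_iff.2 ⟨k, hy, hl, .refl⟩⟩

theorem D_eq_zero_of_full (hA : A.Idealistic) (h : ∀ e ≠ a, A.M i a e = A.m i)
    (hD : A.D i < A.m i) : A.D i = 0 := by
  obtain ⟨y, -, -, hm, hy⟩ := hA.prox_iff_of_full h hD
  have : A.proxSet i = {y} := by
    ext k
    simp [proxSet, hy]
  rw [D, this, Finset.sum_singleton, hm, sub_self]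

end Idealistic

theorem slot_eq_none (h : A.free i a = 1) : A.slot i a = none := by
  by_contra hne
  simp [free, hne] at h

theorem free_eq_one (h : A.slot i a = none) : A.free i a = 1 := if_pos h

theorem full_of_eq (hab : a ≠ b) (hac : a ≠ c) (hbc : b ≠ c) (hb : A.M i a b = A.m i)
    (hc : A.M i a c = A.m i) : ∀ e ≠ a, A.M i a e = A.m i := by
  intro e he
  rcases eq_of_ne hab hac hbc e with rfl | rfl | rfl
  · exact absurd rfl he
  · exact hb
  · exact hc

namespace Idealistic

theorem D_nonneg (hA : A.Idealistic) (i : Fin r) : 0 ≤ A.D i := by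
  have h := rab_le (A.m_pos i)
    (hA.le_D (show (0 : Fin 3) ≠ 1 by decide) (show (0 : Fin 3) ≠ 2 by decide)
      (show (1 : Fin 3) ≠ 2 by decide) i)
    M_nonneg M_nonneg M_nonneg M_nonneg M_nonneg M_nonneg
    (hA i 0 1 (by decide)) (hA i 0 2 (by decide)) (hA i 1 2 (by decide))
  exact (mul_nonneg M_nonneg (by linarith [hA i 0 1 (by decide)])).trans h

theorem full_of_two_free_eq_zero (hA : A.Idealistic) (hab : a ≠ b) (hac : a ≠ c) (hbc : b ≠ c)
    (ha : A.free i a = 0) (hb : A.free i b = 0) (hc : A.free i c = 1) (hχ : A.chi i < 0) :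
    ∃ d, A.slot i d = none ∧ (∀ e ≠ d, A.M i d e = A.m i) ∧ A.D i < A.m i := by
  rw [A.chi_eq hab hac hbc, ha, hb, hc, rab] at hχ
  obtain ⟨h1, h2, h3⟩ := full_of_two_labels (A.m_pos i) (hA.le_D hab hac hbc i)
    ((A.card_children_cases i a b c).imp And.right And.right)
    ((A.card_children_cases i b a c).imp And.right And.right)
    M_nonneg M_nonneg (hA i a b hab) (hA i a c hac) (hA i b c hbc) (by linarith)
  exact ⟨c, slot_eq_none hc, full_of_eq hac.symm hbc.symm hab h1 h2, h3⟩

theorem full_of_one_free_eq_zero (hA : A.Idealistic) (hab : a ≠ b) (hac : a ≠ c) (hbc : b ≠ c)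
    (ha : A.free i a = 0) (hb : A.free i b = 1) (hc : A.free i c = 1) (hχ : A.chi i < 0) :
    ∃ d, A.slot i d = none ∧ (∀ e ≠ d, A.M i d e = A.m i) ∧ A.D i < A.m i := by
  rw [A.chi_eq hab hac hbc, ha, hb, hc, rab, rab] at hχ
  obtain ⟨h, h3⟩ := full_of_one_label (A.m_pos i) (hA.le_D hab hac hbc i)
    (A.card_children_cases i a b c)
    ((A.card_children_cases i b a c).imp And.right And.right)
    ((A.card_children_cases i c a b).imp And.right And.right)
    (hA i a b hab) (hA i a c hac) (hA i b c hbc) (by linarith)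
  rcases h with ⟨h1, h2⟩ | ⟨h1, h2⟩
  · exact ⟨c, slot_eq_none hc, full_of_eq hac.symm hbc.symm hab h1 h2, h3⟩
  · exact ⟨b, slot_eq_none hb, full_of_eq hab.symm hbc hac h1 h2, h3⟩

theorem full_of_free_eq_one (hA : A.Idealistic) (hab : a ≠ b) (hac : a ≠ c) (hbc : b ≠ c)
    (ha : A.free i a = 1) (hb : A.free i b = 1) (hc : A.free i c = 1) (hχ : A.chi i ≤ 0) :
    ∃ d, A.slot i d = none ∧ (∀ e ≠ d, A.M i d e = A.m i) ∧ A.D i < A.m i := by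
  rw [A.chi_eq hab hac hbc, ha, hb, hc, rab, rab, rab] at hχ
  obtain ⟨h, h3⟩ := full_of_no_label (A.m_pos i) (hA.le_D hab hac hbc i)
    (A.card_children_cases i a b c) (A.card_children_cases i b a c)
    (A.card_children_cases i c a b)
    (hA i a b hab) (hA i a c hac) (hA i b c hbc) (by linarith)
  rcases h with ⟨h1, h2⟩ | ⟨h1, h2⟩ | ⟨h1, h2⟩
  · exact ⟨a, slot_eq_none ha, full_of_eq hab hac hbc h1 h2, h3⟩
  · exact ⟨b, slot_eq_none hb, full_of_eq hab.symm hbc hac h1 h2, h3⟩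
  · exact ⟨c, slot_eq_none hc, full_of_eq hac.symm hbc.symm hab h1 h2, h3⟩

/-- The nodes with negative Euler characteristic pass all their weight on in a direction that
does not appear under them. -/
theorem full_of_chi_neg (hA : A.Idealistic) (hχ : A.chi i < 0) :
    ∃ d, A.slot i d = none ∧ (∀ e ≠ d, A.M i d e = A.m i) ∧ A.D i < A.m i := by
  have h01 : (0 : Fin 3) ≠ 1 := by decide
  have h02 : (0 : Fin 3) ≠ 2 := by decide
  have h12 : (1 : Fin 3) ≠ 2 := by decide
  rcases A.free_cases i 0 with h0 | h0 <;> rcases A.free_cases i 1 with h1 | h1 <;>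
    rcases A.free_cases i 2 with h2 | h2
  · rw [A.chi_eq h01 h02 h12, h0, h1, h2] at hχ
    linarith [hA.D_nonneg i]
  · exact hA.full_of_two_free_eq_zero h01 h02 h12 h0 h1 h2 hχ
  · exact hA.full_of_two_free_eq_zero h02 h01 h12.symm h0 h2 h1 hχ
  · exact hA.full_of_one_free_eq_zero h01 h02 h12 h0 h1 h2 hχ
  · exact hA.full_of_two_free_eq_zero h12 h01.symm h02.symm h1 h2 h0 hχ
  · exact hA.full_of_one_free_eq_zero h01.symm h12 h02 h1 h0 h2 hχ
  · exact hA.full_of_one_free_eq_zero h02.symm h12.symm h01 h2 h0 h1 hχ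
  · exact hA.full_of_free_eq_one h01 h02 h12 h0 h1 h2 hχ.le

theorem nu_eq_N (hA : A.Idealistic) (hab : a ≠ b) (hac : a ≠ c) (hbc : b ≠ c)
    (ha : A.slot j a = some i) (hc : A.slot j c = none)
    (hfull : ∀ e ≠ c, A.M j c e = A.m j) (hDj : A.D j = 0) (hDi : 0 < A.D i)
    (hχi : A.chi i = 0) (hχj : A.chi j < 0) (heq : A.nu i * A.N j = A.nu j * A.N i) :
    A.nu i = A.N i := by
  obtain ⟨y, hy, hyc, hmy, -⟩ := hA.prox_iff_of_full hfull (hDj ▸ A.m_pos j)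
  obtain ⟨x, hx, hxa, hr⟩ := A.slot_eq_some_iff.1 ha
  obtain ⟨hxc, hr⟩ := hr.of_slot_eq_none hc
  have hr : A.Reach {b} x j := by
    refine hr.mono ?_
    rintro d ⟨h1, h2⟩
    exact ((eq_of_ne hab hac hbc d).resolve_left h1).resolve_right h2
  have hic : A.slot i c = none := by rwa [A.slot_child hx, hxa, if_neg hac] at hxc
  have hmj := A.m_pos j
  have hmx := A.m_pos x
  have hjc := add_le_treeSum hy hyc
  have hx1 := le_treeSum (A := A) {b} x
  have hx2 := le_treeSum (A := A) {c} x
  have hz : 2 ≤ A.treeSum {c} A.m x ∧ (j = x ∨ A.m x < A.treeSum {b} A.m x) := by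
    constructor
    · cases hr with
      | refl => linarith
      | step _ hj hjb hr =>
        have h1 := hA.m_le_of_reach hr
        have h2 := hA (A.parent j) b c hbc
        rw [M_of_child ⟨hj, rfl⟩ hjb] at h2
        have h3 := M_nonneg (A := A) (i := A.parent j) (a := c) (b := b)
        linarith
    · refine hr.eq_or_child.imp_right ?_
      rintro ⟨z, hz, hzb, -⟩
      linarith [add_le_treeSum hz hzb, A.m_pos z]
  obtain ⟨hz, hjx⟩ := hz
  have hMb : A.M i a b = A.treeSum {b} A.m x := M_of_child hx hxa
  have hMc : A.M i a c = A.treeSum {c} A.m x := M_of_child hx hxa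
  have hcard : ((A.children i a).card : ℤ) = 1 := by
    rw [children_eq_singleton hx hxa, Finset.card_singleton, Nat.cast_one]
  have hD := hA.le_D hab hac hbc i
  have habi := hA i a b hab
  have haci := hA i a c hac
  have hbci := hA i b c hbc
  have fc := free_eq_one hic
  have hχ := A.chi_eq hab hac hbc i
  rw [hχi, fc, hcard] at hχ
  rcases A.free_cases i a with fa | fa <;> rcases A.free_cases i b with fb | fb
  · rw [fa, fb, rab] at hχ
    have := rab_le (A.m_pos i) hD M_nonneg M_nonneg M_nonneg M_nonneg M_nonneg M_nonneg
      habi haci hbci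
    nlinarith
  · exfalso
    rw [fa, fb, rab, rab] at hχ
    have h1 := corner_eq_one hD (by linarith) (by linarith) M_nonneg M_nonneg M_nonneg M_nonneg
      habi haci hbci (by linarith) hDi
    obtain rfl : j = x := hjx.resolve_right (by linarith)
    have hbj : A.slot j b = none := by
      rw [A.slot_child hx, hxa, if_neg hab, slot_eq_none fb]
    have h2 := A.chi_eq hab hac hbc j
    have h3 := hfull a hac
    have h4 := hfull b hbc
    have h5 := hA j a c hac
    have h6 := hA j b c hbc
    have ea : A.children j a = ∅ := children_eq_empty (b := c) (by linarith)
    have eb : A.children j b = ∅ := children_eq_empty (b := c) (by linarith)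
    have h7 : A.M j a b = 0 := by simp [M_eq, ea]
    have h8 : A.M j b a = 0 := by simp [M_eq, eb]
    have h9 : A.M j a c = 0 := by simp [M_eq, ea]
    have h10 : A.free j a = 0 := by simp [free, ha]
    rw [hDj, free_eq_one hc, free_eq_one hbj, h10, ea, rab, rab, h3, h7, h8, h9,
      Finset.card_empty] at h2
    push_cast at h2
    linarith
  · rw [fa, fb, rab, rab, rab] at hχ
    have hfb := A.card_children_cases i b a c
    rcases opposite_corner (A.m_pos i) hD (by linarith) (by linarith) hfb
      ((A.card_children_cases i c a b).imp And.right And.right) habi haci hbci (by linarith) hDi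
      with ⟨h1, h2, h3⟩ | ⟨h1, h2, h3⟩
    · exact absurd (hA.D_eq_zero_of_full (full_of_eq hab hac hbc h1 h2) h3) hDi.ne'
    · have h4 := hA.mul_defect hab hac hbc x
      have h5 := hA x b c hbc
      have h6 : A.slotSum i a (fun k => A.m k ^ 2) =
          A.treeSum {a}ᶜ (fun k => A.m k ^ 2) x := by
        rw [slotSum_eq, children_eq_singleton hx hxa, Finset.sum_singleton]
      rw [D_eq hab hac hbc, h6] at h3
      have h7 := hA.slotSum_sq_le hab.symm hbc hac i
      have h8 := hA.slotSum_sq_le hac.symm hbc.symm hab i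
      have h9 : A.treeSum {b} A.m x = A.m x := by
        rw [← hMb, ← hMc, h1, h2] at h4
        rw [← hMb, h1] at hx1
        rw [← hMb, h1]
        rw [h1, h2] at h3
        have hb0 := M_nonneg (A := A) (i := x) (a := b) (b := c)
        have hc0 := M_nonneg (A := A) (i := x) (a := c) (b := b)
        by_contra hne
        have hp : 1 ≤ A.m i - 1 - A.m x := by omega
        nlinarith [mul_nonneg (show 0 ≤ A.m i - 1 - A.m x by omega)
            (show 0 ≤ A.m x - A.M x b c by linarith),
          mul_nonneg (show 0 ≤ A.m i - A.m x by omega)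
            (show 0 ≤ A.m x - A.M x c b by linarith),
          mul_pos (show 0 < A.m i - 1 - A.m x by omega) (show 0 < A.m i - A.m x by omega)]
      obtain rfl : j = x := hjx.resolve_right (by linarith)
      have hia : A.slot i (A.label j) = none := hxa ▸ slot_eq_none fa
      rw [A.N_child hx hia, A.nu_child hx hia] at heq
      have h10 : A.m j = A.m i - 1 := by linarith
      rw [h10] at heq
      linarith
  · obtain ⟨d, -, h1, h2⟩ := hA.full_of_free_eq_one hab hac hbc fa fb fc hχi.le
    exact absurd (hA.D_eq_zero_of_full h1 h2) hDi.ne'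

end Idealistic

end ToricCluster

open ToricConstellation ToricCluster

theorem stmt16 {r : ℕ} (A : ToricCluster r) (hA : A.Idealistic) (i j : Fin r)
    (hprox : Prox A.toToricConstellation j i ∨ Prox A.toToricConstellation i j)
    (hchii : A.chi i = 0) (hchij : A.chi j < 0)
    (heq : A.nu i * A.N j = A.nu j * A.N i)
    (hRees : (∑ k ∈ A.proxSet i, A.m k ^ 2) < A.m i ^ 2
      ∨ (∑ k ∈ A.proxSet j, A.m k ^ 2) < A.m j ^ 2) :
    A.nu i = A.N i := by
  obtain ⟨c, hc, hfull, hD⟩ := hA.full_of_chi_neg hchij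
  obtain ⟨y, hy, hyc, hmy, hj⟩ := hA.prox_iff_of_full hfull hD
  have hDj := hA.D_eq_zero_of_full hfull hD
  rcases hprox with h | h
  · obtain ⟨a, ha⟩ := A.prox_iff.1 h
    have hac : a ≠ c := by
      rintro rfl
      simp [ha] at hc
    obtain ⟨b, hab, hbc⟩ := exists_third hac
    have hDi : 0 < A.D i := by
      rcases hRees with h | h
      · exact sub_pos.2 h
      · exact absurd hDj (sub_pos.2 h).ne'
    exact hA.nu_eq_N hab hac hbc ha hc hfull hDj hDi hchii hchij heq
  · obtain rfl := (hj i).1 h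
    have hjc : A.slot j (A.label i) = none := hyc ▸ hc
    rw [A.N_child hy hjc, A.nu_child hy hjc, hmy] at heq
    have := A.N_pos j
    linarith
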